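/- Fix positive integers t ≤ m ≤ n, let X be an m×n matrix of indeterminates over a field 𝔽 of prime characteristic, R = 𝔽[X], and for 1 ≤ j ≤ m let I_j be the ideal of j×j minors of X. For every positive integer s, the integral closure of I_t^s equals the intersection over j = 1, …, t of the symbolic powers I_j^{((t−j+1)s)}. -/

import Mathlib

open MvPolynomial

/-- The generic `m × n` matrix `X`, whose entries are the variables `x_{ij}` of the
polynomial ring `𝔽[X]`. -/
noncomputable def genMat (𝔽 : Type*) [Field 𝔽] (m n : ℕ) :
    Matrix (Fin m) (Fin n) (MvPolynomial (Fin m × Fin n) 𝔽) :=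
  Matrix.of fun i j => MvPolynomial.X (i, j)

/-- `f` is a size `s` minor of the generic `m × n` matrix: the determinant of the submatrix
obtained by choosing `s` rows and `s` columns (in increasing order). -/
def IsMinor (𝔽 : Type*) [Field 𝔽] (m n s : ℕ) (f : MvPolynomial (Fin m × Fin n) 𝔽) : Prop :=
  ∃ (row : Fin s → Fin m) (col : Fin s → Fin n), StrictMono row ∧ StrictMono col ∧
    f = ((genMat 𝔽 m n).submatrix row col).det

/-- `I_s ⊆ 𝔽[X]`, the ideal generated by the size `s` minors of the generic matrix. -/
noncomputable def minorsIdeal (𝔽 : Type*) [Field 𝔽] (m n s : ℕ) :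
    Ideal (MvPolynomial (Fin m × Fin n) 𝔽) :=
  Ideal.span {f | IsMinor 𝔽 m n s f}

/-- `x` lies in the integral closure of the ideal `J`: it satisfies an equation
`x^d + a_1 x^{d-1} + ⋯ + a_d = 0` with `a_i ∈ J^i`. -/
def MemIntClosure {R : Type*} [CommRing R] (J : Ideal R) (x : R) : Prop :=
  ∃ (d : ℕ) (a : ℕ → R), 0 < d ∧ (∀ i ∈ Finset.Icc 1 d, a i ∈ J ^ i) ∧
    x ^ d + ∑ i ∈ Finset.Icc 1 d, a i * x ^ (d - i) = 0

/-- The `r`-th symbolic power `P^{(r)} = P^r R_P ∩ R` of a prime ideal `P`, described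
elementwise: `x ∈ P^{(r)}` iff `s·x ∈ P^r` for some `s ∉ P`. -/
def memSymbolicPower {R : Type*} [CommRing R] (P : Ideal R) (r : ℕ) (x : R) : Prop :=
  ∃ u : R, u ∉ P ∧ u * x ∈ P ^ r

namespace GenericDeterminantal

open Matrix

section Determinants

variable {R ι κ μ ν : Type*} [CommRing R] [Fintype ι] [DecidableEq ι] [Fintype κ]

theorem det_mul_eq_sum (A : Matrix ι κ R) (B : Matrix κ ι R) :
    (A * B).det = ∑ f : ι → κ, (∏ i, A i (f i)) * (B.submatrix f id).det := by
  have h := (detRowAlternating (R := R) (n := ι)).toMultilinearMap.map_sum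
    (fun i k => A i k • B k)
  have h1 : (fun i => ∑ k, A i k • B k) = A * B := by
    ext i j
    simp [mul_apply]
  rw [h1] at h
  refine h.trans (Finset.sum_congr rfl fun f _ => ?_)
  exact MultilinearMap.map_smul_univ _ (fun i => A i (f i)) (fun i => B (f i))

theorem dvd_det_mul_diagonal_mul [DecidableEq κ] (A : Matrix ι κ R) (c : κ → R)
    (B : Matrix κ ι R) (q : R)
    (h : ∀ f : ι → κ, Function.Injective f → q ∣ ∏ i, c (f i)) :
    q ∣ (A * diagonal c * B).det := by
  rw [det_mul_eq_sum]
  refine Finset.dvd_sum fun f _ => ?_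
  by_cases hf : Function.Injective f
  · simp only [mul_diagonal, Finset.prod_mul_distrib]
    exact ((h f hf).mul_left _).mul_right _
  · simp only [Function.Injective, not_forall] at hf
    obtain ⟨i, j, hij, hne⟩ := hf
    rw [det_zero_of_row_eq hne (by ext; simp [hij]), mul_zero]
    exact dvd_zero _

theorem det_mul_submatrix_mem {J : Ideal R} {M : Matrix κ ν R}
    (hM : ∀ (f : ι → κ) (g : ι → ν), (M.submatrix f g).det ∈ J)
    (A : Matrix μ κ R) (f : ι → μ) (g : ι → ν) : ((A * M).submatrix f g).det ∈ J := by
  rw [submatrix_mul (e₂ := id) (he₂ := Function.bijective_id), det_mul_eq_sum]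
  refine J.sum_mem fun h _ => J.mul_mem_left _ ?_
  rw [submatrix_submatrix]
  exact hM _ _

theorem det_mul_mul_submatrix_mem {ρ : Type*} [Fintype ν] {J : Ideal R}
    {M : Matrix κ ν R} (hM : ∀ (f : ι → κ) (g : ι → ν), (M.submatrix f g).det ∈ J)
    (A : Matrix μ κ R) (B : Matrix ν ρ R) (f : ι → μ) (g : ι → ρ) :
    ((A * M * B).submatrix f g).det ∈ J := by
  rw [Matrix.mul_assoc]
  refine det_mul_submatrix_mem (fun f g => ?_) A f g
  rw [← det_transpose, transpose_submatrix, transpose_mul]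
  refine det_mul_submatrix_mem (fun f g => ?_) _ _ _
  rw [← det_transpose, transpose_submatrix, transpose_transpose]
  exact hM _ _

end Determinants

section Minors

variable {𝔽 : Type*} [Field 𝔽] {m n : ℕ}

theorem det_submatrix_mem_of_strictMono {R : Type*} [CommRing R] {s : ℕ}
    {M : Matrix (Fin m) (Fin s) R} {J : Ideal R}
    (h : ∀ f : Fin s → Fin m, StrictMono f → (M.submatrix f id).det ∈ J) (f : Fin s → Fin m) :
    (M.submatrix f id).det ∈ J := by
  by_cases hf : Function.Injective f
  · have hs : StrictMono (f ∘ Tuple.sort f) :=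
      (Tuple.monotone_sort f).strictMono_of_injective (hf.comp (Tuple.sort f).injective)
    have h1 := h _ hs
    have h2 : M.submatrix (f ∘ Tuple.sort f) id =
      (M.submatrix f id).submatrix (Tuple.sort f) id := rfl
    rw [h2, det_permute, Ideal.unit_mul_mem_iff_mem] at h1
    · exact h1
    · exact (Tuple.sort f).sign.isUnit.map (Int.castRingHom R)
  · simp only [Function.Injective, not_forall] at hf
    obtain ⟨i, j, hij, hne⟩ := hf
    rw [det_zero_of_row_eq hne (by ext; simp [hij])]
    exact J.zero_mem

theorem det_submatrix_mem_minorsIdeal {ι : Type*} [Fintype ι] [DecidableEq ι]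
    (f : ι → Fin m) (g : ι → Fin n) :
    ((genMat 𝔽 m n).submatrix f g).det ∈ minorsIdeal 𝔽 m n (Fintype.card ι) := by
  have key : ∀ {s : ℕ} (f : Fin s → Fin m) (g : Fin s → Fin n),
      ((genMat 𝔽 m n).submatrix f g).det ∈ minorsIdeal 𝔽 m n s := by
    intro s f g
    refine det_submatrix_mem_of_strictMono (M := (genMat 𝔽 m n).submatrix id g)
      (fun f' hf' => ?_) f
    rw [← det_transpose]
    refine det_submatrix_mem_of_strictMono (M := ((genMat 𝔽 m n).submatrix f' id)ᵀ)
      (fun g' hg' => ?_) g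
    rw [← det_transpose]
    exact Ideal.subset_span ⟨f', g', hf', hg', rfl⟩
  have h := key (f ∘ (Fintype.equivFin ι).symm) (g ∘ (Fintype.equivFin ι).symm)
  rwa [← submatrix_submatrix, det_submatrix_equiv_self] at h

/-- A ring homomorphism out of `𝔽[X]` maps the ideal of minors into `J` as soon as it does so
for the minors of the image of `X`. -/
theorem map_minorsIdeal_le {R : Type*} [CommRing R] (F : MvPolynomial (Fin m × Fin n) 𝔽 →+* R)
    {s : ℕ} {J : Ideal R}
    (h : ∀ (f : Fin s → Fin m) (g : Fin s → Fin n),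
      (((genMat 𝔽 m n).map F).submatrix f g).det ∈ J) :
    (minorsIdeal 𝔽 m n s).map F ≤ J := by
  rw [minorsIdeal, Ideal.map_span, Ideal.span_le]
  rintro _ ⟨_, ⟨f, g, -, -, rfl⟩, rfl⟩
  rw [SetLike.mem_coe, RingHom.map_det]
  exact h f g

theorem map_minorsIdeal_le_span_singleton {R : Type*} [CommRing R]
    (F : MvPolynomial (Fin m × Fin n) 𝔽 →+* R) {κ : Type*} [Fintype κ] [DecidableEq κ]
    {A : Matrix (Fin m) κ R} {c : κ → R} {B : Matrix κ (Fin n) R}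
    (hF : (genMat 𝔽 m n).map F = A * diagonal c * B) {s : ℕ} {q : R}
    (h : ∀ f : Fin s → κ, Function.Injective f → q ∣ ∏ i, c (f i)) :
    (minorsIdeal 𝔽 m n s).map F ≤ Ideal.span {q} := by
  refine map_minorsIdeal_le F fun f g => ?_
  rw [Ideal.mem_span_singleton, hF, submatrix_mul (e₂ := id) (he₂ := Function.bijective_id),
    submatrix_mul (e₂ := id) (he₂ := Function.bijective_id), submatrix_id_id]
  exact dvd_det_mul_diagonal_mul _ _ _ _ h

end Minors

section Combinatorics

variable {m n : ℕ}

/-- `S` contains `r` cells, each strictly below and to the right of the previous one. -/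
def HasChain (r : ℕ) (S : Finset (Fin m × Fin n)) : Prop :=
  ∃ (row : Fin r → Fin m) (col : Fin r → Fin n), StrictMono row ∧ StrictMono col ∧
    ∀ k, (row k, col k) ∈ S

theorem strictMono_cons {k r : ℕ} {a : Fin k} {f : Fin (r + 1) → Fin k} (hf : StrictMono f)
    (ha : a < f 0) : StrictMono (Fin.cons a f : Fin (r + 2) → Fin k) := by
  rw [Fin.strictMono_iff_lt_succ]
  intro i
  induction i using Fin.cases with
  | zero => simpa using ha
  | succ i =>
    rw [Fin.castSucc_succ, Fin.cons_succ, Fin.cons_succ]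
    exact hf i.castSucc_lt_succ

/-- A finite set of cells without a chain of length `r + 1` is a union of `r` antichains. -/
theorem exists_coloring (r : ℕ) (S : Finset (Fin m × Fin n)) (hS : ¬ HasChain (r + 1) S) :
    ∃ c : Fin m × Fin n → ℕ, (∀ v ∈ S, c v < r) ∧
      ∀ v ∈ S, ∀ w ∈ S, c v = c w → ¬ (v.1 < w.1 ∧ v.2 < w.2) := by
  induction r generalizing S with
  | zero =>
    have hS' : ∀ v, v ∉ S := fun v hv => hS
      ⟨fun _ => v.1, fun _ => v.2, Subsingleton.strictMono (α := Fin 1) _,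
        Subsingleton.strictMono (α := Fin 1) _, fun _ => hv⟩
    exact ⟨fun _ => 0, fun v hv => absurd hv (hS' v), fun v hv => absurd hv (hS' v)⟩
  | succ r ih =>
    classical
    obtain ⟨c, hc, hc'⟩ := ih (S.filter fun v => ∃ w ∈ S, w.1 < v.1 ∧ w.2 < v.2) (by
      rintro ⟨row, col, hrow, hcol, hmem⟩
      simp only [Finset.mem_filter] at hmem
      obtain ⟨w, hw, h1, h2⟩ := (hmem 0).2
      refine hS ⟨Fin.cons w.1 row, Fin.cons w.2 col, strictMono_cons hrow h1,
        strictMono_cons hcol h2, fun k => ?_⟩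
      induction k using Fin.cases with
      | zero => simpa using hw
      | succ k => simpa using (hmem k).1)
    simp only [Finset.mem_filter, and_imp] at hc hc'
    refine ⟨fun v => if ∃ w ∈ S, w.1 < v.1 ∧ w.2 < v.2 then c v else r, fun v hv => ?_,
      fun v hv w hw hvw hlt => ?_⟩
    · dsimp only
      split_ifs with h
      · exact (hc v hv h).trans (Nat.lt_succ_self r)
      · exact Nat.lt_succ_self r
    · have hw' : ∃ v ∈ S, v.1 < w.1 ∧ v.2 < w.2 := ⟨v, hv, hlt⟩
      dsimp only at hvw
      rw [if_pos hw'] at hvw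
      split_ifs at hvw with h
      · exact hc' v hv h w hw hw' hvw hlt
      · exact (hc w hw hw').ne hvw.symm

/-- Among the nonnegative integer matrices with given row and column sums, the one supported on
an antichain strictly minimizes the sum of the entries weighted by `(i + 1) * (j + 1)`. -/
theorem sum_weight_le_of_margins {b b' : Fin m → Fin n → ℕ}
    (hrow : ∀ i, ∑ j, b i j = ∑ j, b' i j) (hcol : ∀ j, ∑ i, b i j = ∑ i, b' i j)
    (hanti : ∀ i j k l, b' i j ≠ 0 → b' k l ≠ 0 → ¬ (i < k ∧ j < l)) :
    ∑ i, ∑ j, b' i j * ((i + 1) * (j + 1)) ≤ ∑ i, ∑ j, b i j * ((i + 1) * (j + 1)) ∧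
      (∑ i, ∑ j, b' i j * ((i + 1) * (j + 1)) = ∑ i, ∑ j, b i j * ((i + 1) * (j + 1)) →
        b = b') := by
  let d : Fin m → Fin n → ℤ := fun i j => b i j - b' i j
  let u : ℕ → ℕ → ℤ := fun p i => if p ≤ i then 1 else 0
  let B : ℕ → ℕ → ℤ := fun p q => ∑ i : Fin m, ∑ j : Fin n, u p i * u q j * d i j
  have hdrow : ∀ i, ∑ j, d i j = 0 := fun i => by
    have := congrArg (Nat.cast : ℕ → ℤ) (hrow i)
    push_cast at this
    simp [d, this]
  have hdcol : ∀ j, ∑ i, d i j = 0 := fun j => by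
    have := congrArg (Nat.cast : ℕ → ℤ) (hcol j)
    push_cast at this
    simp [d, this]
  have hB : ∀ p q, 0 ≤ B p q := by
    intro p q
    by_cases h : ∃ i j, p ≤ i.val ∧ q ≤ j.val ∧ b' i j ≠ 0
    · obtain ⟨k, l, hk, hl, hkl⟩ := h
      have h1 : B p q = ∑ i : Fin m, ∑ j : Fin n, (1 - u p i) * (1 - u q j) * d i j := by
        have e1 : ∑ i : Fin m, ∑ j : Fin n, u p i * d i j = 0 := by
          simp only [← Finset.mul_sum, hdrow, mul_zero, Finset.sum_const_zero]
        have e2 : ∑ i : Fin m, ∑ j : Fin n, u q j * d i j = 0 := by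
          rw [Finset.sum_comm]
          simp only [← Finset.mul_sum, hdcol, mul_zero, Finset.sum_const_zero]
        have e3 : ∑ i : Fin m, ∑ j : Fin n, d i j = 0 := by
          simp only [hdrow, Finset.sum_const_zero]
        have e4 : ∑ i : Fin m, ∑ j : Fin n, (1 - u p i) * (1 - u q j) * d i j =
            ∑ i : Fin m, ∑ j : Fin n, d i j - ∑ i : Fin m, ∑ j : Fin n, u p i * d i j -
              ∑ i : Fin m, ∑ j : Fin n, u q j * d i j
              + B p q := by
          simp only [B, ← Finset.sum_sub_distrib, ← Finset.sum_add_distrib]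
          refine Finset.sum_congr rfl fun i _ => Finset.sum_congr rfl fun j _ => ?_
          ring
        rw [e4, e1, e2, e3]
        ring
      rw [h1]
      refine Finset.sum_nonneg fun i _ => Finset.sum_nonneg fun j _ => ?_
      by_cases hi : p ≤ i
      · simp [u, hi]
      by_cases hj : q ≤ j
      · simp [u, hj]
      have h0 : b' i j = 0 := by
        by_contra h0
        exact hanti i j k l h0 hkl ⟨Fin.lt_def.2 (by omega), Fin.lt_def.2 (by omega)⟩
      simp [u, hi, hj, d, h0]
    · push Not at h
      refine Finset.sum_nonneg fun i _ => Finset.sum_nonneg fun j _ => ?_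
      by_cases hi : p ≤ i
      · by_cases hj : q ≤ j
        · simp [u, hi, hj, d, h i j hi hj]
        · simp [u, hj]
      · simp [u, hi]
  have hu : ∀ k : ℕ, ∀ i : Fin k, ∑ p ∈ Finset.range k, u p i = i + 1 := by
    intro k i
    simp only [u, Finset.sum_boole]
    have : (Finset.range k).filter (fun p => p ≤ (i : ℕ)) = Finset.range (i + 1) := by
      ext p
      simp only [Finset.mem_filter, Finset.mem_range]
      omega
    rw [this, Finset.card_range]
    push_cast
    ring
  have hsum : ∑ p ∈ Finset.range m, ∑ q ∈ Finset.range n, B p q =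
      ((∑ i, ∑ j, b i j * ((i + 1) * (j + 1)) : ℕ) : ℤ) -
        ((∑ i, ∑ j, b' i j * ((i + 1) * (j + 1)) : ℕ) : ℤ) := by
    have e : ∑ p ∈ Finset.range m, ∑ q ∈ Finset.range n, B p q =
        ∑ i : Fin m, ∑ j : Fin n, (∑ p ∈ Finset.range m, u p i) *
          (∑ q ∈ Finset.range n, u q j) * d i j := by
      simp only [B]
      simp only [Finset.sum_comm (s := Finset.range n) (t := Finset.univ)]
      rw [Finset.sum_comm]
      refine Finset.sum_congr rfl fun i _ => ?_
      rw [Finset.sum_comm]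
      refine Finset.sum_congr rfl fun j _ => ?_
      simp only [Finset.sum_mul, Finset.mul_sum]
      exact Finset.sum_comm
    rw [e]
    push_cast
    rw [← Finset.sum_sub_distrib]
    refine Finset.sum_congr rfl fun i _ => ?_
    rw [← Finset.sum_sub_distrib]
    refine Finset.sum_congr rfl fun j _ => ?_
    rw [hu, hu]
    simp only [d]
    ring
  have hnonneg : 0 ≤ ∑ p ∈ Finset.range m, ∑ q ∈ Finset.range n, B p q :=
    Finset.sum_nonneg fun p _ => Finset.sum_nonneg fun q _ => hB p q
  refine ⟨by omega, fun heq => ?_⟩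
  have hzero : ∀ p q, B p q = 0 := by
    intro p q
    by_cases hp : p < m
    · by_cases hq : q < n
      · rw [heq, sub_self] at hsum
        have h1 := (Finset.sum_eq_zero_iff_of_nonneg fun p _ =>
          Finset.sum_nonneg fun q _ => hB p q).1 hsum p (Finset.mem_range.2 hp)
        exact (Finset.sum_eq_zero_iff_of_nonneg fun q _ => hB p q).1 h1 q
          (Finset.mem_range.2 hq)
      · refine Finset.sum_eq_zero fun i _ => Finset.sum_eq_zero fun j _ => ?_
        have : ¬ q ≤ j := by omega
        simp [u, this]
    · refine Finset.sum_eq_zero fun i _ => Finset.sum_eq_zero fun j _ => ?_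
      have : ¬ p ≤ i := by omega
      simp [u, this]
  ext k l
  have hdkl : d k l = B k l - B (k + 1) l - B k (l + 1) + B (k + 1) (l + 1) := by
    simp only [B, ← Finset.sum_sub_distrib, ← Finset.sum_add_distrib]
    rw [Finset.sum_eq_single k, Finset.sum_eq_single l]
    · simp [u]
    · intro j _ hj
      have : u (l + 1) j = u l j := by
        have : (l : ℕ) ≠ j := fun h => hj (Fin.ext h.symm)
        simp only [u]
        congr 1
        exact propext ⟨fun _ => by omega, fun _ => by omega⟩
      rw [this]
      ring
    · simp
    · intro i _ hi
      have : u (k + 1) i = u k i := by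
        have : (k : ℕ) ≠ i := fun h => hi (Fin.ext h.symm)
        simp only [u]
        congr 1
        exact propext ⟨fun _ => by omega, fun _ => by omega⟩
      refine Finset.sum_eq_zero fun j _ => ?_
      rw [this]
      ring
    · simp
  simp only [hzero, d] at hdkl
  omega

end Combinatorics

section Straightening

variable {𝔽 : Type*} [Field 𝔽] {m n : ℕ}

/-- The weight on monomials of `𝔽[X]` in which `x_{ij}` has weight `(i + 1) * (j + 1)`. It is
maximal on the main diagonal among the terms of a minor. -/
noncomputable def cellWeight (m n : ℕ) : (Fin m × Fin n →₀ ℕ) →+ ℕ :=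
  Finsupp.weight fun v => ((v.1 : ℕ) + 1) * ((v.2 : ℕ) + 1)

theorem sum_weight_perm_lt {r : ℕ} {row : Fin r → Fin m} {col : Fin r → Fin n}
    (hrow : StrictMono row) (hcol : StrictMono col) {σ : Equiv.Perm (Fin r)} (hσ : σ ≠ 1) :
    cellWeight m n (∑ k, Finsupp.single (row (σ k), col k) 1) <
      cellWeight m n (∑ k, Finsupp.single (row k, col k) 1) := by
  have hmono : Monovary (fun k => (row k : ℕ) + 1) fun k => (col k : ℕ) + 1 := by
    intro i j hij
    have : col i < col j := Fin.lt_def.2 (by simpa using hij)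
    have : row i < row j := hrow (hcol.lt_iff_lt.1 this)
    simpa using this.le
  have h := (hmono.sum_comp_perm_mul_lt_sum_mul_iff (σ := σ)).2 (by
    intro h
    refine hσ ?_
    have hσm : Monotone σ := by
      intro i j hij
      rcases hij.eq_or_lt with rfl | hij
      · exact le_rfl
      · have h1 := h (i := i) (j := j) (by simpa using hcol hij)
        simp only [Function.comp_apply, add_le_add_iff_right, Fin.val_fin_le] at h1
        exact hrow.le_iff_le.1 h1
    have h2 : StrictMono σ := hσm.strictMono_of_injective σ.injective
    ext i
    have h3 := congrArg (fun e : Fin r ≃o Fin r => e i) (Subsingleton.elim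
      (h2.orderIsoOfSurjective σ σ.surjective) (OrderIso.refl (Fin r)))
    simpa using congrArg Fin.val h3)
  simpa [cellWeight, Finsupp.weight_single] using h

theorem exists_sub_mem_minorsIdeal (r : ℕ) (f : MvPolynomial (Fin m × Fin n) 𝔽) :
    ∃ f', f - f' ∈ minorsIdeal 𝔽 m n r ∧ ∀ e ∈ f'.support, ¬ HasChain r e.support := by
  let N : Submodule 𝔽 (MvPolynomial (Fin m × Fin n) 𝔽) :=
    (minorsIdeal 𝔽 m n r).restrictScalars 𝔽 ⊔
      MvPolynomial.restrictSupport 𝔽 {e | ¬ HasChain r e.support}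
  have hmon : ∀ w, ∀ e, cellWeight m n e = w → monomial e (1 : 𝔽) ∈ N := by
    intro w
    induction w using Nat.strong_induction_on with
    | _ w ih =>
      intro e he
      by_cases hch : HasChain r e.support
      · obtain ⟨row, col, hrow, hcol, hmem⟩ := hch
        let p : Equiv.Perm (Fin r) → (Fin m × Fin n →₀ ℕ) :=
          fun σ => ∑ k, Finsupp.single (row (σ k), col k) 1
        have hp : p 1 ≤ e := by
          intro v
          simp only [p, Equiv.Perm.coe_one, id_eq, Finsupp.finsetSum_apply]
          by_cases hv : ∃ k, (row k, col k) = v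
          · obtain ⟨k, rfl⟩ := hv
            rw [Finset.sum_eq_single k]
            · have := hmem k
              rw [Finsupp.mem_support_iff] at this
              simp only [Finsupp.single_eq_same]
              omega
            · intro l _ hl
              refine Finsupp.single_eq_of_ne fun h => hl ?_
              exact (hrow.injective (congrArg Prod.fst h)).symm
            · simp
          · rw [Finset.sum_eq_zero]
            · exact Nat.zero_le _
            · intro k _
              exact Finsupp.single_eq_of_ne fun h => hv ⟨k, h.symm⟩
        obtain ⟨e', rfl⟩ := exists_add_of_le hp
        have hdet : ((genMat 𝔽 m n).submatrix row col).det =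
            ∑ σ : Equiv.Perm (Fin r), Equiv.Perm.sign σ • monomial (p σ) (1 : 𝔽) := by
          rw [det_apply]
          refine Finset.sum_congr rfl fun σ _ => ?_
          simp only [p, monomial_sum_one, genMat, submatrix_apply, of_apply, MvPolynomial.X]
        have hmul : monomial (p 1 + e') (1 : 𝔽) =
            ((genMat 𝔽 m n).submatrix row col).det * monomial e' 1 -
              ∑ σ ∈ Finset.univ.erase 1,
                Equiv.Perm.sign σ • monomial (p σ + e') (1 : 𝔽) := by
          rw [hdet, Finset.sum_mul, ← Finset.add_sum_erase _ _ (Finset.mem_univ 1)]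
          simp only [smul_mul_assoc, monomial_mul, mul_one, Equiv.Perm.sign_one, one_smul,
            add_sub_cancel_right]
        rw [hmul]
        refine N.sub_mem (Submodule.mem_sup_left ?_) (N.sum_mem fun σ hσ => ?_)
        · exact Ideal.mul_mem_right _ _ (Ideal.subset_span ⟨row, col, hrow, hcol, rfl⟩)
        · rw [Units.smul_def]
          refine N.smul_of_tower_mem _ (ih _ ?_ _ rfl)
          rw [← he, map_add, map_add]
          exact Nat.add_lt_add_right
            (sum_weight_perm_lt hrow hcol (Finset.ne_of_mem_erase hσ)) _
      · refine Submodule.mem_sup_right ?_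
        rw [MvPolynomial.mem_restrictSupport_iff]
        refine (Finset.coe_subset.2 support_monomial_subset).trans ?_
        simpa using hch
  have hf : f ∈ N := by
    rw [f.as_sum]
    refine N.sum_mem fun e _ => ?_
    rw [← mul_one (coeff e f), ← smul_eq_mul, ← smul_monomial]
    exact N.smul_mem _ (hmon _ e rfl)
  obtain ⟨g, hg, f', hf', rfl⟩ := Submodule.mem_sup.1 hf
  refine ⟨f', by simpa using hg, fun e he => ?_⟩
  exact ((MvPolynomial.mem_restrictSupport_iff _).1 hf') he

end Straightening

section SecondFundamentalTheorem

variable {𝔽 : Type*} [Field 𝔽] {m n : ℕ}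

/-- The homomorphism which substitutes for `X` a generic matrix of rank at most `r`, namely the
product of generic matrices of sizes `m × r` and `r × n`. -/
noncomputable def genericRankHom (𝔽 : Type*) [Field 𝔽] (m n r : ℕ) :
    MvPolynomial (Fin m × Fin n) 𝔽 →ₐ[𝔽] MvPolynomial ((Fin m × Fin r) ⊕ (Fin r × Fin n)) 𝔽 :=
  aeval fun v => ∑ l, X (Sum.inl (v.1, l)) * X (Sum.inr (l, v.2))

theorem genericRankHom_eq_zero_of_mem {r : ℕ} {f : MvPolynomial (Fin m × Fin n) 𝔽}
    (hf : f ∈ minorsIdeal 𝔽 m n (r + 1)) : genericRankHom 𝔽 m n r f = 0 := by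
  have h := map_minorsIdeal_le_span_singleton (genericRankHom 𝔽 m n r).toRingHom
    (A := of fun i l => X (Sum.inl (i, l))) (c := fun _ : Fin r => 1)
    (B := of fun l j => X (Sum.inr (l, j))) (s := r + 1) (q := 0) (by
      ext i j
      rw [diagonal_one, Matrix.mul_one, mul_apply]
      simp [genericRankHom, genMat]) (by
      intro g hg
      have := Fintype.card_le_of_injective g hg
      simp at this)
  simpa using h (Ideal.mem_map_of_mem _ hf)

/-- The exponent of the image of a monomial under `Y_{l,i,j} ↦ a_{il} b_{lj}`. -/
noncomputable def marginExponent (m n r : ℕ) :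
    (Fin r × Fin m × Fin n →₀ ℕ) →+ ((Fin m × Fin r) ⊕ (Fin r × Fin n) →₀ ℕ) :=
  Finsupp.weight fun w =>
    Finsupp.single (Sum.inl (w.2.1, w.1)) 1 + Finsupp.single (Sum.inr (w.1, w.2.2)) 1

theorem marginExponent_inl {r : ℕ} (β : Fin r × Fin m × Fin n →₀ ℕ) (i : Fin m) (l : Fin r) :
    marginExponent m n r β (Sum.inl (i, l)) = ∑ j, β (l, i, j) := by
  simp only [marginExponent, Finsupp.weight_eq_sum, Finsupp.finsetSum_apply, Finsupp.smul_apply,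
    Finsupp.add_apply, Fintype.sum_prod_type, Finsupp.single_apply, smul_eq_mul]
  simp [ite_and]

theorem marginExponent_inr {r : ℕ} (β : Fin r × Fin m × Fin n →₀ ℕ) (l : Fin r) (j : Fin n) :
    marginExponent m n r β (Sum.inr (l, j)) = ∑ i, β (l, i, j) := by
  simp only [marginExponent, Finsupp.weight_eq_sum, Finsupp.finsetSum_apply, Finsupp.smul_apply,
    Finsupp.add_apply, Fintype.sum_prod_type, Finsupp.single_apply, smul_eq_mul]
  simp [ite_and]

/-- The exponent of the image of a monomial under `Y_{l,i,j} ↦ x_{ij}`. -/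
noncomputable def totalExponent (m n r : ℕ) :
    (Fin r × Fin m × Fin n →₀ ℕ) →+ (Fin m × Fin n →₀ ℕ) :=
  Finsupp.weight fun w => Finsupp.single w.2 1

theorem cellWeight_totalExponent {r : ℕ} (β : Fin r × Fin m × Fin n →₀ ℕ) :
    cellWeight m n (totalExponent m n r β) =
      ∑ l, ∑ i, ∑ j, β (l, i, j) * ((i + 1) * (j + 1)) := by
  simp only [totalExponent, Finsupp.weight_eq_sum, map_sum, map_nsmul]
  simp only [cellWeight, Finsupp.weight_single, Fintype.sum_prod_type, smul_eq_mul, one_mul]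

/-- The substitution of `∑ l, Y_{l,i,j}` for `x_{ij}`. -/
noncomputable def sumHom (𝔽 : Type*) [Field 𝔽] (m n r : ℕ) :
    MvPolynomial (Fin m × Fin n) 𝔽 →ₐ[𝔽] MvPolynomial (Fin r × Fin m × Fin n) 𝔽 :=
  aeval fun v => ∑ l, X (l, v)

theorem totalExponent_mem_support {r : ℕ} {f : MvPolynomial (Fin m × Fin n) 𝔽}
    {β : Fin r × Fin m × Fin n →₀ ℕ} (hβ : coeff β (sumHom 𝔽 m n r f) ≠ 0) :
    totalExponent m n r β ∈ f.support := by
  rw [f.as_sum, map_sum, coeff_sum] at hβ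
  obtain ⟨e, he, hne⟩ := Finset.exists_ne_zero_of_sum_ne_zero hβ
  have hhom : IsWeightedHomogeneous (fun w : Fin r × Fin m × Fin n => Finsupp.single w.2 1)
      (sumHom 𝔽 m n r (monomial e (coeff e f))) e := by
    rw [sumHom, aeval_monomial, algebraMap_eq]
    refine IsWeightedHomogeneous.C_mul ?_ _
    have h := IsWeightedHomogeneous.prod (R := 𝔽) e.support
      (fun v => (∑ l : Fin r, X (l, v)) ^ e v) (fun v => e v • Finsupp.single v 1)
      (w := fun w : Fin r × Fin m × Fin n => Finsupp.single w.2 1) (fun v _ =>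
        (IsWeightedHomogeneous.sum _ _ _ fun l _ => isWeightedHomogeneous_X 𝔽 _ (l, v)).pow _)
    have he' : ∑ v ∈ e.support, e v • Finsupp.single v 1 = e := by
      conv_rhs => rw [← Finsupp.sum_single e]
      simp [Finsupp.sum]
    rwa [he'] at h
  have h := hhom hne
  rw [totalExponent, h]
  exact he

/-- The substitution of `a_{il} b_{lj}` for `Y_{l,i,j}`. -/
noncomputable def rankOneHom (𝔽 : Type*) [Field 𝔽] (m n r : ℕ) :
    MvPolynomial (Fin r × Fin m × Fin n) 𝔽 →ₐ[𝔽]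
      MvPolynomial ((Fin m × Fin r) ⊕ (Fin r × Fin n)) 𝔽 :=
  aeval fun w => X (Sum.inl (w.2.1, w.1)) * X (Sum.inr (w.1, w.2.2))

theorem rankOneHom_monomial {r : ℕ} (β : Fin r × Fin m × Fin n →₀ ℕ) (c : 𝔽) :
    rankOneHom 𝔽 m n r (monomial β c) = monomial (marginExponent m n r β) c := by
  rw [rankOneHom, aeval_monomial, algebraMap_eq, marginExponent, Finsupp.weight_apply,
    Finsupp.sum, ← mul_one c, ← C_mul_monomial, monomial_sum_one, mul_one, Finsupp.prod]
  simp [X, monomial_mul, monomial_pow]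

theorem rankOneHom_sumHom {r : ℕ} (f : MvPolynomial (Fin m × Fin n) 𝔽) :
    rankOneHom 𝔽 m n r (sumHom 𝔽 m n r f) = genericRankHom 𝔽 m n r f := by
  rw [← AlgHom.comp_apply]
  congr 1
  ext v
  simp [rankOneHom, sumHom, genericRankHom]

theorem coeff_sumHom_mapDomain {r : ℕ} (c : Fin m × Fin n → Fin r) (a : Fin m × Fin n →₀ ℕ)
    (f : MvPolynomial (Fin m × Fin n) 𝔽) :
    coeff (a.mapDomain fun v => (c v, v)) (sumHom 𝔽 m n r f) = coeff a f := by
  have hinj : Function.Injective fun v => (c v, v) := fun v w h => congrArg Prod.snd h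
  have h : (killCompl hinj).comp (sumHom 𝔽 m n r) = AlgHom.id 𝔽 _ := by
    ext1 v
    simp only [sumHom, AlgHom.comp_apply, aeval_X, map_sum, AlgHom.id_apply]
    rw [Finset.sum_eq_single (c v)]
    · have := killCompl_rename_app hinj (X v : MvPolynomial (Fin m × Fin n) 𝔽)
      rwa [rename_X] at this
    · intro l _ hl
      rw [killCompl, aeval_X, dif_neg]
      rintro ⟨w, hw⟩
      simp only [Prod.mk.injEq] at hw
      obtain ⟨h1, rfl⟩ := hw
      exact hl h1.symm
    · simp
  rw [← coeff_killCompl hinj, ← AlgHom.comp_apply, h, AlgHom.id_apply]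

theorem eq_mapDomain_of_marginExponent_eq {r : ℕ} {c : Fin m × Fin n → Fin r}
    {a : Fin m × Fin n →₀ ℕ}
    (hc : ∀ v ∈ a.support, ∀ w ∈ a.support, c v = c w → ¬ (v.1 < w.1 ∧ v.2 < w.2))
    {β : Fin r × Fin m × Fin n →₀ ℕ}
    (hβ : marginExponent m n r β = marginExponent m n r (a.mapDomain fun v => (c v, v)))
    (hw : cellWeight m n (totalExponent m n r β) ≤ cellWeight m n a) :
    β = a.mapDomain fun v => (c v, v) := by
  have hinj : Function.Injective fun v => (c v, v) := fun v w h => congrArg Prod.snd h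
  set β' := a.mapDomain fun v => (c v, v) with hβ'
  have htot : totalExponent m n r β' = a := by
    rw [hβ', totalExponent, Finsupp.weight_apply, Finsupp.sum_mapDomain_index
      (h := fun (w : Fin r × Fin m × Fin n) k => k • Finsupp.single w.2 1)
      (fun _ => zero_smul _ _) (fun _ _ _ => add_smul _ _ _)]
    conv_rhs => rw [← Finsupp.sum_single a]
    simp [Finsupp.sum]
  have hsupp : ∀ l v, β' (l, v) ≠ 0 → c v = l ∧ v ∈ a.support := by
    intro l v hne
    have h1 := Finsupp.mapDomain_support (Finsupp.mem_support_iff.2 hne)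
    obtain ⟨w, hw, h2⟩ := Finset.mem_image.1 h1
    simp only [Prod.mk.injEq] at h2
    obtain ⟨h2, rfl⟩ := h2
    exact ⟨h2, hw⟩
  have key := fun l => sum_weight_le_of_margins (b := fun i j => β (l, i, j))
    (b' := fun i j => β' (l, i, j))
    (fun i => by
      have := DFunLike.congr_fun hβ (Sum.inl (i, l))
      rwa [marginExponent_inl, marginExponent_inl] at this)
    (fun j => by
      have := DFunLike.congr_fun hβ (Sum.inr (l, j))
      rwa [marginExponent_inr, marginExponent_inr] at this)
    (fun i j k o h1 h2 => hc _ (hsupp _ _ h1).2 _ (hsupp _ _ h2).2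
      ((hsupp _ _ h1).1.trans (hsupp _ _ h2).1.symm))
  rw [← htot, cellWeight_totalExponent, cellWeight_totalExponent] at hw
  have heq := (Finset.sum_eq_sum_iff_of_le fun l _ => (key l).1).1
    (le_antisymm (Finset.sum_le_sum fun l _ => (key l).1) hw)
  ext ⟨l, i, j⟩
  exact congrFun (congrFun ((key l).2 (heq l (Finset.mem_univ l))) i) j

/-- **Second fundamental theorem** for generic matrices: a polynomial vanishing on the generic
matrix of rank at most `r` lies in the ideal of `(r + 1)`-minors. -/
theorem mem_minorsIdeal_of_genericRankHom_eq_zero {r : ℕ} {f : MvPolynomial (Fin m × Fin n) 𝔽}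
    (hf : genericRankHom 𝔽 m n r f = 0) : f ∈ minorsIdeal 𝔽 m n (r + 1) := by
  obtain ⟨g, hg, hch⟩ := exists_sub_mem_minorsIdeal (r + 1) f
  suffices hg0 : g = 0 by simpa [hg0] using hg
  have hgz : genericRankHom 𝔽 m n r g = 0 := by
    have := genericRankHom_eq_zero_of_mem hg
    rwa [map_sub, hf, zero_sub, neg_eq_zero] at this
  by_contra hg0
  obtain ⟨a, ha, hmax⟩ := Finset.exists_max_image g.support (cellWeight m n)
    (support_nonempty.2 hg0)
  obtain ⟨c, hcr, hc⟩ := exists_coloring r a.support (hch a ha)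
  rcases Nat.eq_zero_or_pos r with rfl | hr
  · have hC : g = C (coeff 0 g) := by
      ext e
      rw [coeff_C]
      split_ifs with h
      · rw [h]
      · by_contra hne
        obtain ⟨c', hc', -⟩ := exists_coloring 0 e.support (hch e (mem_support_iff.2 hne))
        refine h (Finsupp.support_eq_empty.1 (Finset.eq_empty_of_forall_notMem fun v hv => ?_)).symm
        exact absurd (hc' v hv) (Nat.not_lt_zero _)
    rw [hC, algHom_C, algebraMap_eq, C_eq_zero] at hgz
    rw [hgz, C_0] at hC
    exact hg0 hC
  · let c' : Fin m × Fin n → Fin r := fun v => if h : c v < r then ⟨c v, h⟩ else ⟨0, hr⟩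
    have hc' : ∀ v ∈ a.support, ∀ w ∈ a.support, c' v = c' w → ¬ (v.1 < w.1 ∧ v.2 < w.2) := by
      intro v hv w hw h
      refine hc v hv w hw ?_
      simpa [c', hcr v hv, hcr w hw] using h
    have h1 : coeff (marginExponent m n r (a.mapDomain fun v => (c' v, v)))
        (rankOneHom 𝔽 m n r (sumHom 𝔽 m n r g)) = coeff a g := by
      rw [(sumHom 𝔽 m n r g).as_sum, map_sum, coeff_sum, ← coeff_sumHom_mapDomain c' a g]
      simp only [rankOneHom_monomial, coeff_monomial]
      rw [Finset.sum_eq_single (a.mapDomain fun v => (c' v, v)), if_pos rfl]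
      · intro β hβ hne
        rw [if_neg]
        intro hβ'
        refine hne (eq_mapDomain_of_marginExponent_eq hc' hβ' (hmax _ ?_))
        exact totalExponent_mem_support (mem_support_iff.1 hβ)
      · intro h
        rw [if_pos rfl]
        exact notMem_support_iff.1 h
    rw [rankOneHom_sumHom, hgz, coeff_zero] at h1
    exact mem_support_iff.1 ha h1.symm

end SecondFundamentalTheorem

section GenericDiagonal

variable {𝔽 : Type*} [Field 𝔽] {m n : ℕ}

/-- The homomorphism which substitutes for `X` the product `A * D * B`, where `A` and `B` are
generic and `D` is the diagonal matrix with entries `e_0`, `e_0 e_1`, `e_0 e_1 e_2`, …. -/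
noncomputable def diagHom (𝔽 : Type*) [Field 𝔽] (m n : ℕ) :
    MvPolynomial (Fin m × Fin n) 𝔽 →ₐ[𝔽]
      MvPolynomial ((Fin m × Fin m) ⊕ (Fin m × Fin n) ⊕ ℕ) 𝔽 :=
  aeval fun v => ∑ l : Fin m, X (Sum.inl (v.1, l)) *
    (∏ k ∈ Finset.range (l + 1), X (Sum.inr (Sum.inr k))) * X (Sum.inr (Sum.inl (l, v.2)))

theorem X_pow_dvd_diagHom_of_mem {q N : ℕ} {f : MvPolynomial (Fin m × Fin n) 𝔽}
    (hf : f ∈ minorsIdeal 𝔽 m n (q + 1) ^ N) :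
    X (Sum.inr (Sum.inr q)) ^ N ∣ diagHom 𝔽 m n f := by
  have h := map_minorsIdeal_le_span_singleton (diagHom 𝔽 m n).toRingHom
    (A := of fun i l => X (Sum.inl (i, l)))
    (c := fun l => ∏ k ∈ Finset.range (l + 1), X (Sum.inr (Sum.inr k)))
    (B := of fun l j => X (Sum.inr (Sum.inl (l, j)))) (s := q + 1)
    (q := X (Sum.inr (Sum.inr q))) (by
      ext i j
      rw [mul_apply]
      simp [diagHom, genMat]) (by
      intro g hg
      obtain ⟨i, hi⟩ : ∃ i, q ≤ (g i : ℕ) := by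
        by_contra! hlt
        have := Fintype.card_le_of_injective (fun i => (⟨g i, hlt i⟩ : Fin q))
          (fun i j hij => hg (Fin.ext (Fin.mk.inj_iff.1 hij)))
        simp at this
      refine dvd_trans ?_ (Finset.dvd_prod_of_mem _ (Finset.mem_univ i))
      exact Finset.dvd_prod_of_mem _ (Finset.mem_range.2 (Nat.lt_succ_of_le hi)))
  have h1 := Ideal.mem_map_of_mem (diagHom 𝔽 m n).toRingHom hf
  rw [Ideal.map_pow] at h1
  have h2 := Ideal.pow_right_mono h N h1
  rwa [Ideal.span_singleton_pow, Ideal.mem_span_singleton] at h2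

theorem not_X_dvd_diagHom_of_notMem {q : ℕ} (hq : q ≤ m) {f : MvPolynomial (Fin m × Fin n) 𝔽}
    (hf : f ∉ minorsIdeal 𝔽 m n (q + 1)) :
    ¬ X (Sum.inr (Sum.inr q)) ∣ diagHom 𝔽 m n f := by
  obtain ⟨d, rfl⟩ := Nat.exists_eq_add_of_le hq
  intro hdvd
  refine hf (mem_minorsIdeal_of_genericRankHom_eq_zero ?_)
  let ψ : MvPolynomial ((Fin (q + d) × Fin (q + d)) ⊕ (Fin (q + d) × Fin n) ⊕ ℕ) 𝔽 →ₐ[𝔽]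
      MvPolynomial ((Fin (q + d) × Fin q) ⊕ (Fin q × Fin n)) 𝔽 :=
    aeval (Sum.elim (fun w => if h : (w.2 : ℕ) < q then X (Sum.inl (w.1, ⟨w.2, h⟩)) else 0)
      (Sum.elim (fun w => if h : (w.1 : ℕ) < q then X (Sum.inr (⟨w.1, h⟩, w.2)) else 0)
        fun k => if k = q then 0 else 1))
  have hψ : ψ.comp (diagHom 𝔽 (q + d) n) = genericRankHom 𝔽 (q + d) n q := by
    ext1 v
    have h1 : ∀ l : Fin q, (∏ k ∈ Finset.range (l + 1), if k = q then
        (0 : MvPolynomial ((Fin (q + d) × Fin q) ⊕ (Fin q × Fin n)) 𝔽) else 1) = 1 := by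
      intro l
      refine Finset.prod_eq_one fun k hk => if_neg ?_
      have := Finset.mem_range.1 hk
      omega
    simp [ψ, diagHom, genericRankHom, Fin.sum_univ_add, h1]
  rw [← hψ, AlgHom.comp_apply]
  have h := map_dvd ψ hdvd
  have h0 : ψ (X (Sum.inr (Sum.inr q))) = 0 := by simp [ψ]
  rwa [h0, zero_dvd_iff] at h

theorem X_pow_dvd_diagHom_of_memSymbolicPower {q N : ℕ} (hq : q ≤ m)
    {f : MvPolynomial (Fin m × Fin n) 𝔽} (hf : memSymbolicPower (minorsIdeal 𝔽 m n (q + 1)) N f) :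
    X (Sum.inr (Sum.inr q)) ^ N ∣ diagHom 𝔽 m n f := by
  obtain ⟨u, hu, huf⟩ := hf
  have h := X_pow_dvd_diagHom_of_mem huf
  rw [map_mul] at h
  exact (X_prime).pow_dvd_of_dvd_mul_left N (not_X_dvd_diagHom_of_notMem hq hu) h

theorem prod_X_pow_dvd_diagHom {t s : ℕ} (htm : t ≤ m) {f : MvPolynomial (Fin m × Fin n) 𝔽}
    (hf : ∀ j ∈ Finset.Icc 1 t, memSymbolicPower (minorsIdeal 𝔽 m n j) ((t - j + 1) * s) f) :
    (∏ q ∈ Finset.range t, X (Sum.inr (Sum.inr q)) ^ (t - q)) ^ s ∣ diagHom 𝔽 m n f := by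
  rw [← Finset.prod_pow]
  refine Finset.prod_dvd_of_isRelPrime ?_ fun q hq => ?_
  · intro a _ b _ hab
    refine IsRelPrime.pow (IsRelPrime.pow ?_)
    refine (X_prime.irreducible.isRelPrime_iff_not_dvd).2 fun h => hab ?_
    simpa using X_dvd_X.1 h
  · have hq := Finset.mem_range.1 hq
    rw [← pow_mul]
    refine X_pow_dvd_diagHom_of_memSymbolicPower (by omega) ?_
    have := hf (q + 1) (Finset.mem_Icc.2 ⟨by omega, by omega⟩)
    rwa [show t - (q + 1) + 1 = t - q by omega] at this

end GenericDiagonal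

section SmithForm

variable {V : Type*} [CommRing V]

/-- The rectangular diagonal matrix with diagonal entries `e_0`, `e_0 e_1`, `e_0 e_1 e_2`, …. -/
def smithForm (m n : ℕ) (e : ℕ → V) : Matrix (Fin m) (Fin n) V :=
  of fun i j => if (i : ℕ) = j then ∏ k ∈ Finset.range (i + 1), e k else 0

/-- `M` is obtained from `N` by multiplication with matrices on both sides. -/
def IsMultiple {ι κ ι' κ' : Type*} [Fintype ι'] [Fintype κ'] (M : Matrix ι κ V)
    (N : Matrix ι' κ' V) : Prop :=
  ∃ (A : Matrix ι ι' V) (B : Matrix κ' κ V), M = A * N * B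

theorem IsMultiple.trans {ι κ ι' κ' ι'' κ'' : Type*} [Fintype ι'] [Fintype κ'] [Fintype ι'']
    [Fintype κ''] {M : Matrix ι κ V} {N : Matrix ι' κ' V} {P : Matrix ι'' κ'' V}
    (h : IsMultiple M N) (h' : IsMultiple N P) : IsMultiple M P := by
  obtain ⟨A, B, rfl⟩ := h
  obtain ⟨A', B', rfl⟩ := h'
  exact ⟨A * A', B' * B, by simp only [Matrix.mul_assoc]⟩

theorem isMultiple_submatrix {ι κ ι' κ' : Type*} [Fintype ι'] [Fintype κ'] (N : Matrix ι' κ' V)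
    (f : ι → ι') (g : κ → κ') : IsMultiple (N.submatrix f g) N := by
  classical
  refine ⟨(1 : Matrix ι' ι' V).submatrix f id, (1 : Matrix κ' κ' V).submatrix id g, ?_⟩
  ext i j
  simp [mul_apply, one_apply]

theorem isMultiple_of_submatrix_equiv {ι κ ι' κ' : Type*} [Fintype ι] [Fintype κ] [Fintype ι']
    [Fintype κ'] (N : Matrix ι' κ' V) (f : ι ≃ ι') (g : κ ≃ κ') :
    IsMultiple N (N.submatrix f g) := by
  simpa using isMultiple_submatrix (N.submatrix f g) f.symm g.symm

/-- The matrices `M` and `N` are multiples of each other. -/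
def IsBiMultiple {ι κ ι' κ' : Type*} [Fintype ι] [Fintype κ] [Fintype ι'] [Fintype κ']
    (M : Matrix ι κ V) (N : Matrix ι' κ' V) : Prop :=
  IsMultiple M N ∧ IsMultiple N M

theorem IsBiMultiple.trans {ι κ ι' κ' ι'' κ'' : Type*} [Fintype ι] [Fintype κ] [Fintype ι']
    [Fintype κ'] [Fintype ι''] [Fintype κ''] {M : Matrix ι κ V} {N : Matrix ι' κ' V}
    {P : Matrix ι'' κ'' V} (h : IsBiMultiple M N) (h' : IsBiMultiple N P) : IsBiMultiple M P :=
  ⟨h.1.trans h'.1, h'.2.trans h.2⟩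

theorem isBiMultiple_submatrix {ι κ ι' κ' : Type*} [Fintype ι] [Fintype κ] [Fintype ι']
    [Fintype κ'] (N : Matrix ι' κ' V) (f : ι ≃ ι') (g : κ ≃ κ') :
    IsBiMultiple N (N.submatrix f g) :=
  ⟨isMultiple_of_submatrix_equiv N f g, isMultiple_submatrix N f g⟩

theorem isBiMultiple_fromBlocks {ι κ ι' κ' : Type*} [Fintype ι] [Fintype κ] [Fintype ι']
    [Fintype κ'] (d : V) (r : Matrix Unit κ V) (c : Matrix ι Unit V) {N : Matrix ι κ V}
    {D : Matrix ι' κ' V} (h : IsBiMultiple (N - c * r) D) :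
    IsBiMultiple (d • fromBlocks 1 r c N)
      (d • fromBlocks (1 : Matrix Unit Unit V) 0 0 D) := by
  obtain ⟨⟨A, B, hAB⟩, A', B', hAB'⟩ := h
  have hN : N = c * r + A * D * B := by rw [← hAB]; abel
  refine ⟨⟨fromBlocks 1 0 c A, fromBlocks 1 r 0 B, ?_⟩,
    fromBlocks 1 0 (-(A' * c)) A', fromBlocks 1 (-(r * B')) 0 B', ?_⟩
  · rw [Matrix.mul_smul, Matrix.smul_mul, fromBlocks_multiply, fromBlocks_multiply, hN]
    simp
  · rw [Matrix.mul_smul, Matrix.smul_mul, fromBlocks_multiply, fromBlocks_multiply, hAB']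
    simp [Matrix.mul_assoc, Matrix.add_mul, Matrix.mul_add,
      sub_eq_neg_add]

theorem exists_dvd_all [IsDomain V] [ValuationRing V] {α : Type*} [Finite α] [Nonempty α]
    (F : α → V) : ∃ a, ∀ b, F a ∣ F b := by
  have : IsTrans V fun a b => b ∣ a := ⟨fun _ _ _ h h' => h'.trans h⟩
  have hdir : Directed (fun a b : V => b ∣ a) F := fun a b =>
    (ValuationRing.dvd_total (F a) (F b)).elim (fun h => ⟨a, dvd_rfl, h⟩) fun h => ⟨b, h, dvd_rfl⟩
  exact hdir.finite_le id

theorem smithForm_succ (m n : ℕ) (e : ℕ → V) :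
    (smithForm (m + 1) (n + 1) e).submatrix (Sum.elim (fun _ : Unit => 0) Fin.succ)
      (Sum.elim (fun _ : Unit => 0) Fin.succ) =
    e 0 • fromBlocks 1 0 0 (smithForm m n fun k => e (k + 1)) := by
  ext i j
  rcases i with i | i <;> rcases j with j | j <;>
    simp [smithForm, Finset.prod_range_succ']
  split_ifs
  · ring
  · rfl

/-- The bijection splitting off the first index. -/
def unitSumEquiv (n : ℕ) : Unit ⊕ Fin n ≃ Fin (n + 1) where
  toFun := Sum.elim (fun _ => 0) Fin.succ
  invFun := Fin.cases (Sum.inl ()) Sum.inr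
  left_inv := by rintro (_ | _) <;> simp
  right_inv i := by induction i using Fin.cases <;> simp

theorem exists_isBiMultiple_smithForm [IsDomain V] [ValuationRing V] (m n : ℕ)
    (M : Matrix (Fin m) (Fin n) V) : ∃ e : ℕ → V, IsBiMultiple M (smithForm m n e) := by
  induction m generalizing n with
  | zero => exact ⟨0, ⟨1, 1, Subsingleton.elim _ _⟩, 1, 1, Subsingleton.elim _ _⟩
  | succ m ih =>
    cases n with
    | zero => exact ⟨0, ⟨1, 1, Subsingleton.elim _ _⟩, 1, 1, Subsingleton.elim _ _⟩
    | succ n =>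
      obtain ⟨⟨i₀, j₀⟩, h⟩ := exists_dvd_all fun v : Fin (m + 1) × Fin (n + 1) => M v.1 v.2
      choose! Q hQ using h
      let σ := (unitSumEquiv m).trans (Equiv.swap 0 i₀)
      let τ := (unitSumEquiv n).trans (Equiv.swap 0 j₀)
      set d := M i₀ j₀ with hd
      let r : Matrix Unit (Fin n) V := of fun _ j => Q (i₀, τ (Sum.inr j))
      let c : Matrix (Fin m) Unit V := of fun i _ => Q (σ (Sum.inr i), j₀)
      let N : Matrix (Fin m) (Fin n) V := of fun i j => Q (σ (Sum.inr i), τ (Sum.inr j))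
      have hσ : ∀ u, σ (Sum.inl u) = i₀ := fun u => by simp [σ, unitSumEquiv]
      have hτ : ∀ u, τ (Sum.inl u) = j₀ := fun u => by simp [τ, unitSumEquiv]
      have hM : M.submatrix σ τ = d • fromBlocks 1 r c N := by
        ext i j
        rcases i with i | i <;> rcases j with j | j
        · simp [hσ, hτ, hd]
        · simpa [hσ, r] using hQ (i₀, τ (Sum.inr j))
        · simpa [hτ, c] using hQ (σ (Sum.inr i), j₀)
        · simpa [N] using hQ (σ (Sum.inr i), τ (Sum.inr j))
      obtain ⟨e, he⟩ := ih n (N - c * r)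
      let e' : ℕ → V := fun k => Nat.casesOn k d e
      refine ⟨e', (isBiMultiple_submatrix M σ τ).trans ?_⟩
      rw [hM]
      refine (isBiMultiple_fromBlocks d r c he).trans ?_
      have h := isBiMultiple_submatrix (smithForm (m + 1) (n + 1) e')
        (unitSumEquiv m) (unitSumEquiv n)
      have h' := smithForm_succ m n e'
      exact ⟨h'.symm ▸ h.2, h'.symm ▸ h.1⟩

end SmithForm

section Valuative

variable {R : Type*} [CommRing R]

theorem memIntClosure_of_aeval_inv_eq_one {K : Type*} [Field K] [Algebra R K]
    (hinj : Function.Injective (algebraMap R K)) {J : Ideal R} {x : R} (hx : x ≠ 0)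
    {p : Polynomial R} (hp : p ∈ reesAlgebra J) (hp0 : p.coeff 0 = 0)
    (h : Polynomial.aeval (algebraMap R K x)⁻¹ p = 1) : MemIntClosure J x := by
  have hx' : algebraMap R K x ≠ 0 := by
    rwa [Ne, map_eq_zero_iff _ hinj]
  refine ⟨p.natDegree + 1, fun i => -p.coeff i, Nat.succ_pos _,
    fun i _ => neg_mem ((mem_reesAlgebra_iff J p).1 hp i), hinj ?_⟩
  have h1 : ∑ i ∈ Finset.Icc 1 (p.natDegree + 1),
      algebraMap R K (p.coeff i) * (algebraMap R K x)⁻¹ ^ i = 1 := by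
    rw [← h, Polynomial.aeval_eq_sum_range' (Nat.lt_succ_of_lt p.natDegree.lt_succ_self),
      Finset.sum_range_succ', hp0, zero_smul, add_zero, Finset.range_eq_Ico,
      Finset.sum_Ico_add' (fun i => p.coeff i • (algebraMap R K x)⁻¹ ^ i)]
    exact Finset.sum_congr rfl fun i _ => (Algebra.smul_def _ _).symm
  have h2 := congrArg (algebraMap R K x ^ (p.natDegree + 1) * ·) h1
  simp only [Finset.mul_sum, mul_one] at h2
  simp only [map_add, map_pow, map_sum, map_mul, map_neg, map_zero, neg_mul,
    Finset.sum_neg_distrib]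
  rw [add_neg_eq_zero, ← h2]
  refine Finset.sum_congr rfl fun i hi => ?_
  rw [pow_sub₀ _ hx' (Finset.mem_Icc.1 hi).2]
  ring

theorem memIntClosure_of_forall_valuationSubring [IsDomain R] {J : Ideal R} {x : R} (hx : x ≠ 0)
    (h : ∀ (V : ValuationSubring (FractionRing R)) (ρ : R →+* V),
      (∀ r, (ρ r : FractionRing R) = algebraMap R (FractionRing R) r) → ρ x ∈ J.map ρ) :
    MemIntClosure J x := by
  have hinj := IsFractionRing.injective R (FractionRing R)
  set K := FractionRing R
  set ξ := algebraMap R K x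
  have hξ : ξ ≠ 0 := by rwa [Ne, map_eq_zero_iff _ hinj]
  let φ : reesAlgebra J →+* K :=
    ((Polynomial.aeval ξ⁻¹ : Polynomial R →ₐ[R] K) : Polynomial R →+* K).comp
      (reesAlgebra J).val.toRingHom
  let ε : reesAlgebra J →+* R := Polynomial.constantCoeff.comp (reesAlgebra J).val.toRingHom
  by_cases htop : (RingHom.ker ε).map φ.rangeRestrict = ⊤
  · have h1 : (1 : φ.range) ∈ (RingHom.ker ε).map φ.rangeRestrict := htop ▸ Submodule.mem_top
    obtain ⟨p, hp, hp1⟩ :=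
      (Ideal.mem_map_iff_of_surjective _ φ.rangeRestrict_surjective).1 h1
    exact memIntClosure_of_aeval_inv_eq_one hinj hx p.2
      (by simpa [ε, RingHom.mem_ker] using hp) (congrArg Subtype.val hp1)
  · exfalso
    obtain ⟨V, hV, hVn⟩ := Ideal.image_subset_nonunits_valuationSubring _ htop
    have hmem : ∀ r : R, algebraMap R K r ∈ V := fun r =>
      hV ⟨algebraMap R (reesAlgebra J) r, by simp [φ]⟩
    let ρ : R →+* V := (algebraMap R K).codRestrict V.toSubring hmem
    have key : ∀ y ∈ J.map ρ, V.valuation (y : K) < V.valuation ξ := by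
      intro y hy
      have hξ0 : 0 < V.valuation ξ := zero_lt_iff.2 ((V.valuation.ne_zero_iff).2 hξ)
      refine Submodule.span_induction ?_ ?_ ?_ ?_ hy
      · rintro _ ⟨a, ha, rfl⟩
        have hmem : Polynomial.monomial 1 a ∈ reesAlgebra J :=
          reesAlgebra.monomial_mem.2 (by simpa using ha)
        have := hVn ⟨φ.rangeRestrict ⟨_, hmem⟩, Ideal.mem_map_of_mem _ (by
          simp [ε, RingHom.mem_ker, Polynomial.coeff_monomial]), rfl⟩
        rw [SetLike.mem_coe, V.mem_nonunits_iff] at this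
        have h2 : φ ⟨_, hmem⟩ = algebraMap R K a * ξ⁻¹ := by simp [φ]
        change V.valuation (φ ⟨_, hmem⟩) < 1 at this
        rw [h2, map_mul, map_inv₀, ← div_eq_mul_inv, div_lt_one₀ hξ0] at this
        exact this
      · simpa using hξ0
      · intro a b _ _ ha hb
        exact V.valuation.map_add_lt ha hb
      · intro a b _ hb
        simp only [smul_eq_mul, MulMemClass.coe_mul, map_mul]
        exact lt_of_le_of_lt (mul_le_of_le_one_left' (V.valuation_le_one a)) hb
    exact lt_irrefl _ (key _ (h V ρ fun r => rfl))

end Valuative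

section ValuationRing

variable {𝔽 : Type*} [Field 𝔽] {m n : ℕ}

/-- The specialization of the generic product `A * D * B` at given matrices `A`, `B` and given
entries `e_k`. -/
noncomputable def specializeHom {V : Type*} [CommRing V] (σ : 𝔽 →+* V)
    (A : Matrix (Fin m) (Fin m) V) (B : Matrix (Fin m) (Fin n) V) (e : ℕ → V) :
    MvPolynomial ((Fin m × Fin m) ⊕ (Fin m × Fin n) ⊕ ℕ) 𝔽 →+* V :=
  eval₂Hom σ (Sum.elim (fun v => A v.1 v.2) (Sum.elim (fun v => B v.1 v.2) e))

/-- The rectangular matrix with entries `1` on the main diagonal and `0` elsewhere. -/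
def rectOne {V : Type*} [CommRing V] (m n : ℕ) : Matrix (Fin m) (Fin n) V :=
  of fun i j => if (i : ℕ) = j then 1 else 0

theorem smithForm_eq_diagonal_mul {V : Type*} [CommRing V] (e : ℕ → V) :
    smithForm m n e = diagonal (fun l : Fin m => ∏ k ∈ Finset.range (l + 1), e k) *
      (rectOne m n : Matrix (Fin m) (Fin n) V) := by
  ext i j
  rw [diagonal_mul]
  simp [smithForm, rectOne]

theorem specializeHom_comp_diagHom {V : Type*} [CommRing V]
    (ρ : MvPolynomial (Fin m × Fin n) 𝔽 →+* V) {A : Matrix (Fin m) (Fin m) V}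
    {B : Matrix (Fin n) (Fin n) V} {e : ℕ → V}
    (h : (genMat 𝔽 m n).map ρ = A * smithForm m n e * B) :
    (specializeHom (ρ.comp C) A ((rectOne m n : Matrix (Fin m) (Fin n) V) * B) e).comp
      (diagHom 𝔽 m n).toRingHom = ρ := by
  refine MvPolynomial.ringHom_ext (fun r => ?_) fun v => ?_
  · simp [specializeHom, diagHom, algebraMap_eq]
  · rw [smithForm_eq_diagonal_mul, ← Matrix.mul_assoc, Matrix.mul_assoc] at h
    have h1 := congrFun (congrFun h v.1) v.2
    rw [mul_apply] at h1
    simpa [specializeHom, diagHom, genMat, eq_comm] using h1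

theorem prod_prod_range_eq {V : Type*} [CommMonoid V] (e : ℕ → V) (t : ℕ) :
    ∏ i : Fin t, ∏ k ∈ Finset.range (i + 1), e k = ∏ q ∈ Finset.range t, e q ^ (t - q) := by
  rw [Fin.prod_univ_eq_prod_range (fun i => ∏ k ∈ Finset.range (i + 1), e k)]
  induction t with
  | zero => simp
  | succ t ih =>
    rw [Finset.prod_range_succ, ih, Finset.prod_range_succ, Finset.prod_range_succ, ← mul_assoc,
      ← Finset.prod_mul_distrib, Nat.add_sub_cancel_left, pow_one]
    congr 1
    refine Finset.prod_congr rfl fun q hq => ?_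
    rw [← pow_succ, Nat.succ_sub (Finset.mem_range.1 hq).le]

theorem prod_pow_mem_map_minorsIdeal {V : Type*} [CommRing V]
    (ρ : MvPolynomial (Fin m × Fin n) 𝔽 →+* V) {A : Matrix (Fin m) (Fin m) V}
    {B : Matrix (Fin n) (Fin n) V} {e : ℕ → V}
    (h : smithForm m n e = A * (genMat 𝔽 m n).map ρ * B) {t : ℕ} (htm : t ≤ m) (htn : t ≤ n) :
    ∏ q ∈ Finset.range t, e q ^ (t - q) ∈ (minorsIdeal 𝔽 m n t).map ρ := by
  have h1 := det_mul_mul_submatrix_mem (J := (minorsIdeal 𝔽 m n t).map ρ)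
    (M := (genMat 𝔽 m n).map ρ) (ι := Fin t) (fun f g => by
      have := Ideal.mem_map_of_mem ρ (det_submatrix_mem_minorsIdeal (𝔽 := 𝔽) f g)
      rwa [Fintype.card_fin, RingHom.map_det] at this) A B (Fin.castLE htm) (Fin.castLE htn)
  rw [← h] at h1
  have h2 : (smithForm m n e).submatrix (Fin.castLE htm) (Fin.castLE htn) =
      diagonal fun i : Fin t => ∏ k ∈ Finset.range (i + 1), e k := by
    ext i j
    simp [smithForm, diagonal_apply, Fin.ext_iff]
  rwa [h2, det_diagonal, prod_prod_range_eq] at h1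

theorem memIntClosure_of_memSymbolicPower {t s : ℕ} (htm : t ≤ m) (htn : t ≤ n)
    {x : MvPolynomial (Fin m × Fin n) 𝔽}
    (hx : ∀ j ∈ Finset.Icc 1 t, memSymbolicPower (minorsIdeal 𝔽 m n j) ((t - j + 1) * s) x) :
    MemIntClosure (minorsIdeal 𝔽 m n t ^ s) x := by
  rcases eq_or_ne x 0 with rfl | hx0
  · exact ⟨1, 0, one_pos, fun i _ => zero_mem _, by simp⟩
  refine memIntClosure_of_forall_valuationSubring hx0 fun V ρ _ => ?_
  obtain ⟨e, ⟨A, B, h⟩, A', B', h'⟩ :=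
    exists_isBiMultiple_smithForm m n ((genMat 𝔽 m n).map ρ)
  have hdvd := map_dvd (specializeHom (ρ.comp C) A
    ((rectOne m n : Matrix (Fin m) (Fin n) V) * B) e) (prod_X_pow_dvd_diagHom htm hx)
  have hρ := congrArg (· x) (specializeHom_comp_diagHom ρ h)
  simp only [RingHom.comp_apply, AlgHom.toRingHom_eq_coe, RingHom.coe_coe] at hρ
  rw [hρ] at hdvd
  simp only [specializeHom, map_pow, map_prod, coe_eval₂Hom, eval₂_X, Sum.elim_inr] at hdvd
  rw [Ideal.map_pow]
  exact Ideal.mem_of_dvd _ hdvd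
    (Ideal.pow_mem_pow (prod_pow_mem_map_minorsIdeal ρ h' htm htn) s)

end ValuationRing

theorem pow_dvd_of_integral_eq {A : Type*} [CommRing A] [IsDomain A] {π y : A}
    (hπ : Prime π) {d N : ℕ} {b : ℕ → A} (hb : ∀ i ∈ Finset.Icc 1 d, π ^ (N * i) ∣ b i)
    (h : y ^ d + ∑ i ∈ Finset.Icc 1 d, b i * y ^ (d - i) = 0) : π ^ N ∣ y := by
  by_contra hN
  obtain ⟨k, hk, hk'⟩ : ∃ k, π ^ k ∣ y ∧ ¬ π ^ (k + 1) ∣ y := by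
    by_contra! hk
    exact hN (Nat.rec (by simp) hk N)
  have hkN : k < N := by
    by_contra! hle
    exact hN ((pow_dvd_pow π hle).trans hk)
  obtain ⟨g, rfl⟩ := hk
  have hg : ¬ π ∣ g := fun hg => hk' (by rw [pow_succ]; exact mul_dvd_mul_left _ hg)
  have h1 : π ^ (k * d + 1) ∣ (π ^ k * g) ^ d := by
    rw [eq_neg_of_add_eq_zero_left h, dvd_neg]
    refine Finset.dvd_sum fun i hi => ?_
    obtain ⟨c, hc⟩ := hb i hi
    obtain ⟨h1, h2⟩ := Finset.mem_Icc.1 hi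
    obtain ⟨e, rfl⟩ := Nat.exists_eq_add_of_le h2
    rw [hc, Nat.add_sub_cancel_left, mul_pow, ← pow_mul]
    refine (pow_dvd_pow π (n := N * i + k * e) ?_).trans ⟨c * g ^ e, by ring⟩
    nlinarith
  rw [mul_pow, ← pow_mul, pow_succ] at h1
  exact hg (hπ.dvd_of_dvd_pow ((mul_dvd_mul_iff_left (pow_ne_zero _ hπ.ne_zero)).1 h1))

theorem eval_one_mem_pow_of_X_pow_dvd {L : Type*} [CommRing L] {J : Ideal L} {y : Polynomial L}
    (hy : y ∈ reesAlgebra J) {N : ℕ} (h : Polynomial.X ^ N ∣ y) : y.eval 1 ∈ J ^ N := by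
  rw [Polynomial.eval_eq_sum_range]
  refine sum_mem fun k _ => ?_
  rw [one_pow, mul_one]
  rcases lt_or_ge k N with hk | hk
  · rw [Polynomial.X_pow_dvd_iff.1 h k hk]
    exact zero_mem _
  · exact Ideal.pow_le_pow_right hk ((mem_reesAlgebra_iff J y).1 hy k)

section Deformation

variable {𝔽 : Type*} [Field 𝔽] {m n q : ℕ} {L : Type*} [CommRing L]

/-- The Schur complement of the upper left `q × q` block, extended by zero. -/
noncomputable def schurPart (hm : q ≤ m) (hn : q ≤ n) (M : Matrix (Fin m) (Fin n) L) :
    Matrix (Fin m) (Fin n) L :=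
  M - M.submatrix id (Fin.castLE hn) *
    ((M.submatrix (Fin.castLE hm) (Fin.castLE hn))⁻¹ * M.submatrix (Fin.castLE hm) id)

theorem det_mul_schurPart (hm : q ≤ m) (hn : q ≤ n) (M : Matrix (Fin m) (Fin n) L)
    (h : IsUnit (M.submatrix (Fin.castLE hm) (Fin.castLE hn)).det) (a : Fin m) (b : Fin n) :
    (M.submatrix (Fin.castLE hm) (Fin.castLE hn)).det * schurPart hm hn M a b =
      (M.submatrix (Sum.elim (Fin.castLE hm) fun _ : Unit => a)
        (Sum.elim (Fin.castLE hn) fun _ : Unit => b)).det := by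
  let _ := invertibleOfIsUnitDet _ h
  have h1 := det_fromBlocks₁₁ (M.submatrix (Fin.castLE hm) (Fin.castLE hn))
    (M.submatrix (Fin.castLE hm) fun _ : Unit => b)
    (M.submatrix (fun _ : Unit => a) (Fin.castLE hn))
    (M.submatrix (fun _ : Unit => a) fun _ : Unit => b)
  have h2 : M.submatrix (Sum.elim (Fin.castLE hm) fun _ : Unit => a)
      (Sum.elim (Fin.castLE hn) fun _ : Unit => b) =
      fromBlocks (M.submatrix (Fin.castLE hm) (Fin.castLE hn))
        (M.submatrix (Fin.castLE hm) fun _ : Unit => b)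
        (M.submatrix (fun _ : Unit => a) (Fin.castLE hn))
        (M.submatrix (fun _ : Unit => a) fun _ : Unit => b) := by
    ext i j
    rcases i with i | i <;> rcases j with j | j <;> rfl
  rw [h2, h1, det_unique (n := Unit), invOf_eq_nonsing_inv, Matrix.mul_assoc]
  rfl

theorem schurPart_mem (hm : q ≤ m) (hn : q ≤ n) (ι : MvPolynomial (Fin m × Fin n) 𝔽 →+* L)
    (h : IsUnit (((genMat 𝔽 m n).map ι).submatrix (Fin.castLE hm) (Fin.castLE hn)).det)
    (a : Fin m) (b : Fin n) :
    schurPart hm hn ((genMat 𝔽 m n).map ι) a b ∈ (minorsIdeal 𝔽 m n (q + 1)).map ι := by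
  rw [← Ideal.unit_mul_mem_iff_mem _ h, det_mul_schurPart hm hn _ h]
  have h1 := Ideal.mem_map_of_mem ι (det_submatrix_mem_minorsIdeal (𝔽 := 𝔽)
    (Sum.elim (Fin.castLE hm) fun _ : Unit => a) (Sum.elim (Fin.castLE hn) fun _ : Unit => b))
  rw [RingHom.map_det, RingHom.mapMatrix_apply, ← submatrix_map] at h1
  simpa using h1

/-- The homomorphism which multiplies the Schur complement of the upper left `q × q` block by a
new variable. -/
noncomputable def deformHom (hm : q ≤ m) (hn : q ≤ n)
    (ι : MvPolynomial (Fin m × Fin n) 𝔽 →+* L) :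
    MvPolynomial (Fin m × Fin n) 𝔽 →+* Polynomial L :=
  eval₂Hom ((Polynomial.C.comp ι).comp C) fun v =>
    Polynomial.C (ι (X v) - schurPart hm hn ((genMat 𝔽 m n).map ι) v.1 v.2) +
      Polynomial.X * Polynomial.C (schurPart hm hn ((genMat 𝔽 m n).map ι) v.1 v.2)

theorem eval_one_deformHom (hm : q ≤ m) (hn : q ≤ n)
    (ι : MvPolynomial (Fin m × Fin n) 𝔽 →+* L) (f : MvPolynomial (Fin m × Fin n) 𝔽) :
    (deformHom hm hn ι f).eval 1 = ι f := by
  have h : (Polynomial.evalRingHom 1).comp (deformHom hm hn ι) = ι :=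
    MvPolynomial.ringHom_ext (fun r => by simp [deformHom]) fun v => by simp [deformHom]
  exact congrArg (· f) h

theorem deformHom_mem_reesAlgebra (hm : q ≤ m) (hn : q ≤ n)
    (ι : MvPolynomial (Fin m × Fin n) 𝔽 →+* L)
    (h : IsUnit (((genMat 𝔽 m n).map ι).submatrix (Fin.castLE hm) (Fin.castLE hn)).det)
    (f : MvPolynomial (Fin m × Fin n) 𝔽) :
    deformHom hm hn ι f ∈ reesAlgebra ((minorsIdeal 𝔽 m n (q + 1)).map ι) := by
  induction f using MvPolynomial.induction_on with
  | C r =>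
    rw [deformHom, coe_eval₂Hom, eval₂_C]
    exact Subalgebra.algebraMap_mem _ _
  | add f g hf hg => rw [map_add]; exact add_mem hf hg
  | mul_X f v hf =>
    rw [map_mul]
    refine mul_mem hf ?_
    rw [deformHom, coe_eval₂Hom, eval₂_X]
    refine add_mem (Subalgebra.algebraMap_mem _ _) ?_
    rw [mul_comm, ← pow_one Polynomial.X, Polynomial.C_mul_X_pow_eq_monomial]
    refine reesAlgebra.monomial_mem.2 ?_
    rw [pow_one]
    exact schurPart_mem hm hn ι h v.1 v.2

theorem map_deformHom_minorsIdeal_le (hm : q ≤ m) (hn : q ≤ n)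
    (ι : MvPolynomial (Fin m × Fin n) 𝔽 →+* L) (t : ℕ) :
    (minorsIdeal 𝔽 m n t).map (deformHom hm hn ι) ≤ Ideal.span {Polynomial.X ^ (t - q)} := by
  let M := (genMat 𝔽 m n).map ι
  let S := schurPart hm hn M
  refine map_minorsIdeal_le_span_singleton (κ := Fin q ⊕ Fin n) (deformHom hm hn ι)
    (A := fromCols ((M.submatrix id (Fin.castLE hn)).map Polynomial.C) (S.map Polynomial.C))
    (c := Sum.elim 1 fun _ => Polynomial.X)
    (B := fromRows (((M.submatrix (Fin.castLE hm) (Fin.castLE hn))⁻¹ *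
      M.submatrix (Fin.castLE hm) id).map Polynomial.C) 1) ?_ fun f hf => ?_
  · have h1 : M - S = M.submatrix id (Fin.castLE hn) *
        ((M.submatrix (Fin.castLE hm) (Fin.castLE hn))⁻¹ * M.submatrix (Fin.castLE hm) id) :=
      sub_sub_cancel _ _
    have h2 : fromCols ((M.submatrix id (Fin.castLE hn)).map Polynomial.C)
        (S.map Polynomial.C) *
        diagonal (Sum.elim (1 : Fin q → Polynomial L) fun _ : Fin n => Polynomial.X) =
        fromCols ((M.submatrix id (Fin.castLE hn)).map Polynomial.C)
          ((Polynomial.X : Polynomial L) • S.map Polynomial.C) := by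
      ext1 i j
      rw [mul_diagonal]
      rcases j with j | j
      · simp
      · simp
    rw [h2, fromCols_mul_fromRows, Matrix.mul_one, ← Matrix.map_mul, ← h1]
    ext1 i j
    simp [deformHom, genMat, M, S]
  · have h1 : Polynomial.X ^ (Finset.univ.filter fun i => (f i).isRight = true).card ∣
        ∏ i, Sum.elim (1 : Fin q → Polynomial L) (fun _ : Fin n => Polynomial.X) (f i) := by
      rw [← Finset.prod_const]
      refine (Finset.prod_dvd_prod_of_dvd _ (fun i => Sum.elim (1 : Fin q → Polynomial L)
        (fun _ : Fin n => Polynomial.X) (f i)) fun i hi => ?_).trans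
        (Finset.prod_dvd_prod_of_subset _ _ _ (Finset.filter_subset _ _))
      obtain ⟨j, hj⟩ := Sum.isRight_iff.1 (Finset.mem_filter.1 hi).2
      simp [hj]
    refine (pow_dvd_pow _ ?_).trans h1
    have h2 : (Finset.univ.filter fun i => ¬ (f i).isRight = true).card ≤ q := by
      have : (Finset.univ.filter fun i => ¬ (f i).isRight = true).image f ⊆
          (Finset.univ : Finset (Fin q)).map Function.Embedding.inl := by
        intro u hu
        obtain ⟨i, hi, rfl⟩ := Finset.mem_image.1 hu
        have := (Finset.mem_filter.1 hi).2
        rcases hfi : f i with j | j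
        · simp
        · simp [hfi] at this
      have h3 := Finset.card_le_card this
      rwa [Finset.card_image_of_injective _ hf, Finset.card_map, Finset.card_univ,
        Fintype.card_fin] at h3
    have h3 := Finset.card_filter_add_card_filter_not (s := (Finset.univ : Finset (Fin t)))
      (fun i => (f i).isRight = true)
    rw [Finset.card_univ, Fintype.card_fin] at h3
    omega

theorem map_mem_pow_of_memIntClosure [IsDomain L] (hm : q ≤ m) (hn : q ≤ n)
    (ι : MvPolynomial (Fin m × Fin n) 𝔽 →+* L)
    (h : IsUnit (((genMat 𝔽 m n).map ι).submatrix (Fin.castLE hm) (Fin.castLE hn)).det)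
    {t s : ℕ} {x : MvPolynomial (Fin m × Fin n) 𝔽}
    (hx : MemIntClosure (minorsIdeal 𝔽 m n t ^ s) x) :
    ι x ∈ (minorsIdeal 𝔽 m n (q + 1) ^ ((t - q) * s)).map ι := by
  obtain ⟨d, a, _, ha, hax⟩ := hx
  rw [Ideal.map_pow, ← eval_one_deformHom hm hn ι x]
  refine eval_one_mem_pow_of_X_pow_dvd (deformHom_mem_reesAlgebra hm hn ι h x) ?_
  refine pow_dvd_of_integral_eq Polynomial.prime_X (d := d)
    (b := fun i => deformHom hm hn ι (a i)) (fun i hi => ?_) ?_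
  · have h1 := Ideal.mem_map_of_mem (deformHom hm hn ι) (ha i hi)
    rw [Ideal.map_pow, Ideal.map_pow] at h1
    have h2 := Ideal.pow_right_mono
      (Ideal.pow_right_mono (map_deformHom_minorsIdeal_le hm hn ι t) s) i h1
    rwa [Ideal.span_singleton_pow, Ideal.span_singleton_pow, Ideal.mem_span_singleton,
      ← pow_mul, ← pow_mul, ← mul_assoc] at h2
  · simpa using congrArg (deformHom hm hn ι) hax

theorem det_pow_notMem_minorsIdeal (hm : q ≤ m) (hn : q ≤ n) (k : ℕ) :
    ((genMat 𝔽 m n).submatrix (Fin.castLE hm) (Fin.castLE hn)).det ^ k ∉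
      minorsIdeal 𝔽 m n (q + 1) := by
  intro hmem
  let E : Matrix (Fin m) (Fin n) 𝔽 := (rectOne m q : Matrix (Fin m) (Fin q) 𝔽) *
    diagonal (1 : Fin q → 𝔽) * (rectOne q n : Matrix (Fin q) (Fin n) 𝔽)
  let ε : MvPolynomial (Fin m × Fin n) 𝔽 →+* 𝔽 := eval fun v => E v.1 v.2
  have hε : (genMat 𝔽 m n).map ε = E := by
    ext i j
    simp [ε, genMat]
  have h1 := map_minorsIdeal_le_span_singleton (s := q + 1) (q := 0) ε hε fun f hf => by
    simpa using Fintype.card_le_of_injective f hf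
  have h2 := h1 (Ideal.mem_map_of_mem ε hmem)
  have h3 : E.submatrix (Fin.castLE hm) (Fin.castLE hn) = 1 := by
    ext i j
    simp [E, mul_apply, rectOne, one_apply, Fin.val_inj]
  rw [map_pow, RingHom.map_det, RingHom.mapMatrix_apply, ← submatrix_map, hε, h3, det_one,
    one_pow, Ideal.mem_span_singleton, zero_dvd_iff] at h2
  exact one_ne_zero h2

theorem memSymbolicPower_of_memIntClosure (hm : q ≤ m) (hn : q ≤ n) {t s : ℕ}
    {x : MvPolynomial (Fin m × Fin n) 𝔽} (hx : MemIntClosure (minorsIdeal 𝔽 m n t ^ s) x) :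
    memSymbolicPower (minorsIdeal 𝔽 m n (q + 1)) ((t - q) * s) x := by
  set δ := ((genMat 𝔽 m n).submatrix (Fin.castLE hm) (Fin.castLE hn)).det with hδ
  have hδ0 : δ ≠ 0 := fun h0 => det_pow_notMem_minorsIdeal (𝔽 := 𝔽) hm hn 1 (by
    rw [← hδ, h0, pow_one]; exact zero_mem _)
  have hle : Submonoid.powers δ ≤ nonZeroDivisors (MvPolynomial (Fin m × Fin n) 𝔽) :=
    powers_le_nonZeroDivisors_of_noZeroDivisors hδ0
  have : IsDomain (Localization.Away δ) := IsLocalization.isDomain_localization hle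
  have hu : IsUnit (((genMat 𝔽 m n).map (algebraMap _ (Localization.Away δ))).submatrix
      (Fin.castLE hm) (Fin.castLE hn)).det := by
    rw [submatrix_map, ← RingHom.mapMatrix_apply, ← RingHom.map_det]
    exact IsLocalization.Away.algebraMap_isUnit δ
  have h := map_mem_pow_of_memIntClosure hm hn _ hu hx
  rw [IsLocalization.mem_map_algebraMap_iff (Submonoid.powers δ)] at h
  obtain ⟨⟨⟨y, hy⟩, ⟨_, k, rfl⟩⟩, hyx⟩ := h
  rw [← map_mul] at hyx
  have h1 : x * δ ^ k = y := IsLocalization.injective (Localization.Away δ) hle hyx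
  refine ⟨δ ^ k, det_pow_notMem_minorsIdeal hm hn k, ?_⟩
  rwa [mul_comm (δ ^ k), h1]

end Deformation

end GenericDeterminantal

/-- **(Bruns)** For `0 < t ≤ m ≤ n` and every positive integer `s`, the integral closure of
`I_t^s` equals the intersection of the symbolic powers `I_j^{((t-j+1)s)}` for `j = 1, …, t`. -/
theorem integralClosure_pow_eq_inter_symbolicPowers (p : ℕ) (hp : p.Prime)
    (𝔽 : Type*) [Field 𝔽] [CharP 𝔽 p]
    (m n t : ℕ) (ht : 0 < t) (htm : t ≤ m) (hmn : m ≤ n)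
    (s : ℕ) (hs : 0 < s) :
    ∀ x : MvPolynomial (Fin m × Fin n) 𝔽,
      MemIntClosure (minorsIdeal 𝔽 m n t ^ s) x ↔
      ∀ j ∈ Finset.Icc 1 t, memSymbolicPower (minorsIdeal 𝔽 m n j) ((t - j + 1) * s) x := by
  
  intro x
  refine ⟨fun hx j hj => ?_, GenericDeterminantal.memIntClosure_of_memSymbolicPower htm
    (htm.trans hmn)⟩
  obtain ⟨h1, h2⟩ := Finset.mem_Icc.1 hj
  obtain ⟨q, rfl⟩ := Nat.exists_eq_add_of_le' h1
  have h := GenericDeterminantal.memSymbolicPower_of_memIntClosure (q := q) (by omega) (by omega) hx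
  rwa [show t - (q + 1) + 1 = t - q by omega]
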